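/- Let α ∈ (1/2, 1] and a > 0. Then for every t ≥ 0 with t ≠ a, t^α · (t^{1−α} − a^{1−α})/(t − a) ≤ 1. Consequently, if (λ_i)_{i ≥ 1} is a decreasing sequence of strictly positive real numbers, then for each i, sup_{l ≠ i} [ (λ_i^{1−α} − λ_l^{1−α})/(λ_i − λ_l) ] · λ_l^α ≤ 1. -/

import Mathlib

theorem rpow_mul_slope_rpow_one_sub_le_one {α : ℝ} (h0 : 0 < α) {a t : ℝ}
    (ha : 0 < a) (ht : 0 ≤ t) (hta : t ≠ a) :
    t ^ α * ((t ^ (1 - α) - a ^ (1 - α)) / (t - a)) ≤ 1 := by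
  have split : ∀ x : ℝ, 0 ≤ x → x ^ α * x ^ (1 - α) = x := fun x hx => by
    rw [← Real.rpow_add' hx (by simp), add_sub_cancel, Real.rpow_one]
  have hpos : 0 ≤ a ^ (1 - α) := Real.rpow_nonneg ha.le _
  rw [← mul_div_assoc, mul_sub, split t ht]
  rcases hta.lt_or_gt with h | h
  · rw [div_le_one_of_neg (by linarith)]
    have := mul_le_mul_of_nonneg_right (Real.rpow_le_rpow ht h.le h0.le) hpos
    linarith [split a ha.le]
  · rw [div_le_one (by linarith)]
    have := mul_le_mul_of_nonneg_right (Real.rpow_le_rpow ha.le h.le h0.le) hpos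
    linarith [split a ha.le]

/-- for α ∈ (1/2, 1] and a > 0, every t ≥ 0 with t ≠ a satisfies
t^α (t^{1−α} − a^{1−α})/(t − a) ≤ 1; consequently, for any strictly decreasing
sequence (λ_i) of strictly positive reals and any i,
sup_{l ≠ i} (λ_i^{1−α} − λ_l^{1−α})/(λ_i − λ_l) · λ_l^α ≤ 1. -/
theorem statement18 (α : ℝ) (hα : α ∈ Set.Ioc (1/2 : ℝ) 1) :
    (∀ a : ℝ, 0 < a → ∀ t : ℝ, 0 ≤ t → t ≠ a →
      t ^ α * ((t ^ (1 - α) - a ^ (1 - α)) / (t - a)) ≤ 1) ∧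
    (∀ lam : ℕ → ℝ, (∀ i, 0 < lam i) → StrictAnti lam →
      ∀ i l : ℕ, i ≠ l →
        (lam i ^ (1 - α) - lam l ^ (1 - α)) / (lam i - lam l) * lam l ^ α ≤ 1) := by
  have h0 : 0 < α := by linarith [hα.1]
  refine ⟨fun a ha t ht hta => rpow_mul_slope_rpow_one_sub_le_one h0 ha ht hta,
    fun lam hlam hanti i l hil => ?_⟩
  rw [mul_comm, ← neg_sub (lam l ^ (1 - α)), ← neg_sub (lam l), neg_div_neg_eq]
  exact rpow_mul_slope_rpow_one_sub_le_one h0 (hlam i) (hlam l).le (hanti.injective.ne hil.symm)
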